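/- arXiv:cs/0010021 — 4 statements merged into one kernel-verified Lean document; each statement's English description precedes it below -/
import Mathlib

section
/- Let A be a β_A × h matrix and B a β_B × h matrix, both with entries in {−1, 0, +1}, let β = β_A + β_B, let α > 0, and let P_0 ∈ ℝ. Then there exist action functions S^i_t (for i ∈ {1,…,h} and t ∈ {1,…,β}) for an AS+FI market with h strategies, a price sequence P_0, P_1, …, P_β, and an assignment of each row of A and each row of B to a distinct day t ∈ {1,…,β}, such that for every vector x = (X_1, …, X_h) of nonnegative integers and every day t ∈ {1,…,β}: the fixed-increment price equation P_t = P_{t−1} + α·sgn(Σ_{i=1}^h X_i · S^i_t(P_0,…,P_{t−1})) holds if and only if x satisfies the constraint assigned to day t, namely the strict inequality (Ax)_r > 0 if day t carries row r of A, or the equation (Bx)_r = 0 if day t carries row r of B. -/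
/-- Lemma: inequalities to AS+FI market.
Given matrices `A : βA × h` and `B : βB × h` with entries in `{-1,0,1}`, a unit
`α > 0` and an initial price `P₀`, there exist action functions
`S i t : (history of length t) → {-1,0,1}`, a price sequence `P` starting at
`P₀`, and an assignment (a bijection `e`) of the rows of `A` and `B` to the
days `1,…,βA+βB`, such that for every vector `x` of nonnegative integers and
every day `t`, the fixed-increment price equation holds on day `t` iff `x`
satisfies the row constraint assigned to day `t` (the strict inequality
`(A x)_r > 0` for a row of `A`, the equation `(B x)_r = 0` for a row of `B`). -/
theorem stmt_1 (h βA βB : ℕ) (A : Fin βA → Fin h → ℤ) (B : Fin βB → Fin h → ℤ)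
    (hA : ∀ r i, A r i ∈ ({-1, 0, 1} : Set ℤ))
    (hB : ∀ r i, B r i ∈ ({-1, 0, 1} : Set ℤ))
    (α : ℝ) (hα : 0 < α) (P₀ : ℝ) :
    ∃ (S : Fin h → (t : ℕ) → (Fin t → ℝ) → ℤ) (P : ℕ → ℝ)
      (e : Fin βA ⊕ Fin βB ≃ {t : ℕ // t ∈ Finset.Icc 1 (βA + βB)}),
      (∀ i t hist, S i t hist ∈ ({-1, 0, 1} : Set ℤ)) ∧
      P 0 = P₀ ∧
      (∀ x : Fin h → ℤ, (∀ i, 0 ≤ x i) →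
        ∀ t (ht : t ∈ Finset.Icc 1 (βA + βB)),
          ((P t = P (t - 1)
              + α * ((∑ i, x i * S i t (fun j => P j.1)).sign : ℝ)) ↔
            Sum.elim (fun r => 0 < ∑ i, A r i * x i)
              (fun r => ∑ i, B r i * x i = 0) (e.symm ⟨t, ht⟩))) := by
  letI : Fintype {t : ℕ // t ∈ Finset.Icc 1 (βA + βB)} :=
    Fintype.subtype (Finset.Icc 1 (βA + βB)) (fun _ => Iff.rfl)
  have hcard : Fintype.card (Fin βA ⊕ Fin βB)
      = Fintype.card {t : ℕ // t ∈ Finset.Icc 1 (βA + βB)} := by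
    rw [Fintype.card_of_subtype (Finset.Icc 1 (βA + βB)) (fun _ => Iff.rfl)]; simp
  let e := Fintype.equivOfCardEq hcard
  let d : ℕ → ℝ := fun t => if ht : t ∈ Finset.Icc 1 (βA + βB) then
    Sum.elim (fun _ => (1 : ℝ)) (fun _ => 0) (e.symm ⟨t, ht⟩) else 0
  refine ⟨fun i t _ => if ht : t ∈ Finset.Icc 1 (βA + βB) then
    Sum.elim (fun r => A r i) (fun r => B r i) (e.symm ⟨t, ht⟩) else 0,
    fun t => P₀ + α * ∑ s ∈ Finset.range t, d (s + 1), e, ?_, ?_, ?_⟩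
  · intro i t _
    dsimp only
    split_ifs with ht
    · rcases e.symm ⟨t, ht⟩ with r | r
      · exact hA r i
      · exact hB r i
    · simp
  · simp
  · intro x _ t ht
    obtain ⟨s, rfl⟩ : ∃ s, t = s + 1 :=
      ⟨t - 1, by have := (Finset.mem_Icc.mp ht).1; omega⟩
    have key : ∀ z : ℝ, (P₀ + α * ∑ u ∈ Finset.range (s + 1), d (u + 1)
        = P₀ + α * ∑ u ∈ Finset.range s, d (u + 1) + α * z) ↔ d (s + 1) = z := by
      intro z
      rw [Finset.sum_range_succ, mul_add, ← add_assoc, add_right_inj]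
      exact mul_right_inj' hα.ne'
    simp only [Nat.add_sub_cancel]
    rw [key]
    simp only [d, dif_pos ht]
    rcases e.symm ⟨s + 1, ht⟩ with r | r
    · simp only [Sum.elim_inl, mul_comm (x _)]
      rw [← Int.sign_eq_one_iff_pos]
      constructor
      · intro hh; exact_mod_cast hh.symm
      · intro hh; rw [hh]; simp
    · simp only [Sum.elim_inr, mul_comm (x _)]
      rw [← Int.sign_eq_zero_iff_zero]
      constructor
      · intro hh; exact_mod_cast hh.symm
      · intro hh; rw [hh]; simp
end

section
/- Let B be a β × h matrix with entries in {−1, 0, +1}, let b ∈ ℝ^β, let α > 0, and let P_0 ∈ ℝ. Then there exist action functions S^i_t (for i ∈ {1,…,h} and t ∈ {1,…,β}) for an AS+PI market with h strategies and a price sequence P_0, P_1, …, P_β, with day t corresponding to the t-th row of B, such that for every vector x = (X_1, …, X_h) of nonnegative integers and every day t ∈ {1,…,β}: the proportional-increment price equation P_t = P_{t−1} + α·Σ_{i=1}^h X_i · S^i_t(P_0,…,P_{t−1}) holds if and only if (Bx)_t = b_t. -/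
/-- Lemma: equations to AS+PI market.
Given a `β × h` matrix `B` with entries in `{-1,0,1}`, a vector `b : ℝ^β`, a
unit `α > 0` and an initial price `P₀`, there exist action functions
`S i t : (history of length t) → {-1,0,1}` and a price sequence `P` starting at
`P₀` (day `t+1` corresponding to row `t` of `B`) such that for every vector `x`
of nonnegative integers and every day, the proportional-increment price
equation holds on that day iff `x` satisfies the corresponding equation of
`B x = b`. -/
theorem stmt_3 (h β : ℕ) (B : Fin β → Fin h → ℤ)
    (hB : ∀ r i, B r i ∈ ({-1, 0, 1} : Set ℤ))
    (b : Fin β → ℝ) (α : ℝ) (hα : 0 < α) (P₀ : ℝ) :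
    ∃ (S : Fin h → (t : ℕ) → (Fin t → ℝ) → ℤ) (P : ℕ → ℝ),
      (∀ i t hist, S i t hist ∈ ({-1, 0, 1} : Set ℤ)) ∧
      P 0 = P₀ ∧
      (∀ x : Fin h → ℤ, (∀ i, 0 ≤ x i) →
        ∀ t : Fin β,
          ((P (t.1 + 1) = P t.1
              + α * ((∑ i, x i * S i (t.1 + 1) (fun j => P j.1) : ℤ) : ℝ)) ↔
            ∑ i, (B t i : ℝ) * (x i : ℝ) = b t)) := by
  classical
  refine ⟨fun i t _ => if ht : t - 1 < β then B ⟨t - 1, ht⟩ i else 0,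
    fun n => P₀ + α * ∑ k ∈ Finset.range n, (if hk : k < β then b ⟨k, hk⟩ else 0), ?_, ?_, ?_⟩
  · intro i t _
    by_cases ht : t - 1 < β
    · simpa only [ht, dite_true] using hB ⟨t - 1, ht⟩ i
    · simp [ht]
  · simp
  · intro x _ t
    have hsum : ((∑ i, x i * B t i : ℤ) : ℝ) = ∑ i, (B t i : ℝ) * (x i : ℝ) := by
      push_cast
      exact Finset.sum_congr rfl fun i _ => mul_comm _ _
    simp only [Finset.sum_range_succ, Nat.add_sub_cancel, t.2, dite_true, Fin.eta]
    rw [hsum, mul_add, ← add_assoc, add_right_inj, mul_right_inj' hα.ne']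
    exact eq_comm
end

section
/- For any NOR circuit C with n inputs and m gates, there exist a (3m+2) × (n+m+2) matrix A with entries in {−1, 0, +1} and a vector c ∈ {−1, 0, +1}^{n+m+2} with the following properties: (1) every 0-1 vector (x_1, …, x_n) ∈ {0,1}^n has a unique extension x = (x_1, …, x_n, x_{n+1}, …, x_{n+m+2}) ∈ {0,1}^{n+m+2} satisfying Ax > 0 entrywise; and (2) for every x ∈ {0,1}^{n+m+2} with Ax > 0, one has c·x > 0 if and only if C(x_1, …, x_n) = 1. -/
/-- Wire values of a NOR circuit with `n` inputs and `m` NOR gates: wire `j < n`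
is input `j`; wire `n + k` (for `k < m`) is the NOR of the two earlier wires
`(g k).1` and `(g k).2`; the circuit output is wire `n + m - 1` (the last gate). -/
def norWires (n m : ℕ) (g : (k : Fin m) → Fin (n + k.1) × Fin (n + k.1))
    (x : Fin n → Bool) : ℕ → Bool
  | j =>
    if hj : j < n then x ⟨j, hj⟩
    else if hk : j - n < m then
      have := (g ⟨j - n, hk⟩).1.isLt
      have := (g ⟨j - n, hk⟩).2.isLt
      !(norWires n m g x ((g ⟨j - n, hk⟩).1 : ℕ)
        || norWires n m g x ((g ⟨j - n, hk⟩).2 : ℕ))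
    else false
termination_by j => j
decreasing_by
  · omega
  · omega

/-- Indicator of the coordinate `j`. -/
def dl {N : ℕ} (j : ℕ) (i : Fin N) : ℤ := if i.1 = j then 1 else 0

lemma sum_dl {N : ℕ} (j : ℕ) (h : j < N) (x : Fin N → ℤ) :
    ∑ i, dl j i * x i = x ⟨j, h⟩ := by
  rw [Finset.sum_eq_single ⟨j, h⟩]
  · simp [dl]
  · intro b _ hb
    have : b.1 ≠ j := fun h' => hb (Fin.ext h')
    simp [dl, this]
  · simp

/-- The rows of the matrix. -/
def rowA (n m : ℕ) (g : (k : Fin m) → Fin (n + k.1) × Fin (n + k.1))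
    (r : Fin (3 * m + 2)) (i : Fin (n + m + 2)) : ℤ :=
  if h : r.1 / 3 < m then
    if r.1 % 3 = 0 then
      dl (n + m) i + dl (n + m + 1) i - dl (n + r.1 / 3) i - dl (g ⟨r.1 / 3, h⟩).1.1 i
    else if r.1 % 3 = 1 then
      dl (n + m) i + dl (n + m + 1) i - dl (n + r.1 / 3) i - dl (g ⟨r.1 / 3, h⟩).2.1 i
    else
      dl (n + r.1 / 3) i + dl (g ⟨r.1 / 3, h⟩).1.1 i +
        (if (g ⟨r.1 / 3, h⟩).1.1 = (g ⟨r.1 / 3, h⟩).2.1 then 0 else 1) *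
          dl (g ⟨r.1 / 3, h⟩).2.1 i
  else if r.1 = 3 * m then dl (n + m) i else dl (n + m + 1) i

lemma rowA_mem (n m : ℕ) (g : (k : Fin m) → Fin (n + k.1) × Fin (n + k.1))
    (r : Fin (3 * m + 2)) (i : Fin (n + m + 2)) : rowA n m g r i ∈ ({-1, 0, 1} : Set ℤ) := by
  simp only [Set.mem_insert_iff, Set.mem_singleton_iff]
  unfold rowA
  by_cases h : r.1 / 3 < m
  · have h1 := (g ⟨r.1 / 3, h⟩).1.isLt
    have h2 := (g ⟨r.1 / 3, h⟩).2.isLt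
    rw [dif_pos h]
    simp only at h1 h2
    generalize ((g ⟨r.1 / 3, h⟩).1 : ℕ) = a at *
    generalize ((g ⟨r.1 / 3, h⟩).2 : ℕ) = b at *
    unfold dl
    split_ifs <;> omega
  · rw [dif_neg h]
    unfold dl
    split_ifs <;> omega

lemma rows_iff (n m : ℕ) (g : (k : Fin m) → Fin (n + k.1) × Fin (n + k.1))
    (x : Fin (n + m + 2) → ℤ) (hx : ∀ i, x i ∈ ({0, 1} : Set ℤ)) :
    (∀ r, 0 < ∑ i, rowA n m g r i * x i) ↔
      x ⟨n + m, by omega⟩ = 1 ∧ x ⟨n + m + 1, by omega⟩ = 1 ∧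
      ∀ k : Fin m, (x ⟨n + k.1, by omega⟩ = 1 ↔
        x ⟨(g k).1.1, by have := (g k).1.isLt; omega⟩ = 0 ∧
        x ⟨(g k).2.1, by have := (g k).2.isLt; omega⟩ = 0) := by
  have hx' : ∀ i, x i = 0 ∨ x i = 1 := fun i => by simpa using hx i
  have e3 : ∑ i, rowA n m g ⟨3 * m, by omega⟩ i * x i = x ⟨n + m, by omega⟩ := by
    rw [← sum_dl (_ : ℕ) _ x]
    refine Finset.sum_congr rfl fun i _ => ?_
    rw [rowA, dif_neg (by simp), if_pos rfl]
  have e4 : ∑ i, rowA n m g ⟨3 * m + 1, by omega⟩ i * x i = x ⟨n + m + 1, by omega⟩ := by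
    rw [← sum_dl (_ : ℕ) _ x]
    refine Finset.sum_congr rfl fun i _ => ?_
    rw [rowA, dif_neg (by simp only; omega), if_neg (by simp)]
  have e0 : ∀ (r : Fin (3 * m + 2)) (h : r.1 / 3 < m), ∑ i, rowA n m g r i * x i =
      if r.1 % 3 = 0 then
        x ⟨n + m, by omega⟩ + x ⟨n + m + 1, by omega⟩ - x ⟨n + r.1 / 3, by omega⟩
          - x ⟨(g ⟨r.1 / 3, h⟩).1.1, by have := (g ⟨r.1 / 3, h⟩).1.isLt; simp only at this; omega⟩
      else if r.1 % 3 = 1 then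
        x ⟨n + m, by omega⟩ + x ⟨n + m + 1, by omega⟩ - x ⟨n + r.1 / 3, by omega⟩
          - x ⟨(g ⟨r.1 / 3, h⟩).2.1, by have := (g ⟨r.1 / 3, h⟩).2.isLt; simp only at this; omega⟩
      else
        x ⟨n + r.1 / 3, by omega⟩
          + x ⟨(g ⟨r.1 / 3, h⟩).1.1, by have := (g ⟨r.1 / 3, h⟩).1.isLt; simp only at this; omega⟩
          + (if (g ⟨r.1 / 3, h⟩).1.1 = (g ⟨r.1 / 3, h⟩).2.1 then 0 else 1) *
          x ⟨(g ⟨r.1 / 3, h⟩).2.1,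
            by have := (g ⟨r.1 / 3, h⟩).2.isLt; simp only at this; omega⟩ := by
    intro r h
    have hlt1 := (g ⟨r.1 / 3, h⟩).1.isLt
    have hlt2 := (g ⟨r.1 / 3, h⟩).2.isLt
    simp only at hlt1 hlt2
    rw [← sum_dl (n + m) (by omega) x, ← sum_dl (n + m + 1) (by omega) x,
      ← sum_dl (n + r.1 / 3) (by omega) x, ← sum_dl (g ⟨r.1 / 3, h⟩).1.1 (by omega) x,
      ← sum_dl (g ⟨r.1 / 3, h⟩).2.1 (by omega) x]
    unfold rowA
    simp only [dif_pos h]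
    split_ifs <;>
      simp only [add_mul, sub_mul, Finset.sum_add_distrib, Finset.sum_sub_distrib, one_mul,
        zero_mul, Finset.sum_const_zero]
  constructor
  · intro H
    have h3 := H ⟨3 * m, by omega⟩
    have h4 := H ⟨3 * m + 1, by omega⟩
    rw [e3] at h3
    rw [e4] at h4
    have t1 := (hx' ⟨n + m, by omega⟩).resolve_left (by omega)
    have u1 := (hx' ⟨n + m + 1, by omega⟩).resolve_left (by omega)
    refine ⟨t1, u1, fun k => ?_⟩
    have key : ∀ (s : ℕ) (hs : s < 3), 0 < 
      if s = 0 then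
        x ⟨n + m, by omega⟩ + x ⟨n + m + 1, by omega⟩ - x ⟨n + k.1, by omega⟩
          - x ⟨(g k).1.1, by have := (g k).1.isLt; omega⟩
      else if s = 1 then
        x ⟨n + m, by omega⟩ + x ⟨n + m + 1, by omega⟩ - x ⟨n + k.1, by omega⟩
          - x ⟨(g k).2.1, by have := (g k).2.isLt; omega⟩
      else
        x ⟨n + k.1, by omega⟩
          + x ⟨(g k).1.1, by have := (g k).1.isLt; omega⟩
          + (if (g k).1.1 = (g k).2.1 then 0 else 1) *
          x ⟨(g k).2.1, by have := (g k).2.isLt; omega⟩ := by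
      intro s hs
      obtain ⟨k, hk⟩ := k
      have hr := H ⟨3 * k + s, by omega⟩
      have q : (3 * k + s) / 3 = k := by omega
      have q' : (3 * k + s) % 3 = s := by omega
      rw [e0 _ (by simp only; omega)] at hr
      have gg : ∀ k k' : Fin m, k = k' →
          (g k).1.1 = (g k').1.1 ∧ (g k).2.1 = (g k').2.1 := by
        rintro k _ rfl
        exact ⟨rfl, rfl⟩
      have g1 := gg ⟨(3 * k + s) / 3, by omega⟩ ⟨k, hk⟩ (Fin.ext q)
      simp only [g1.1, g1.2, q, q'] at hr
      exact hr
    have k0 := key 0 (by omega)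
    have k1 := key 1 (by omega)
    have k2 := key 2 (by omega)
    simp only [if_true, one_ne_zero, if_false, OfNat.ofNat_ne_zero, OfNat.ofNat_ne_one] at k0 k1 k2
    have a1 := hx' ⟨n + k.1, by omega⟩
    have a2 := hx' ⟨(g k).1.1, by have := (g k).1.isLt; omega⟩
    have a3 := hx' ⟨(g k).2.1, by have := (g k).2.isLt; omega⟩
    split_ifs at k2 with hab
    · simp only [hab] at *
      omega
    · omega
  · rintro ⟨t1, u1, H⟩ r
    by_cases h : r.1 / 3 < m
    · rw [e0 r h]
      have hk := H ⟨r.1 / 3, h⟩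
      have hlt1 := (g ⟨r.1 / 3, h⟩).1.isLt
      have hlt2 := (g ⟨r.1 / 3, h⟩).2.isLt
      simp only at hk hlt1 hlt2
      have a1 := hx' ⟨n + r.1 / 3, by omega⟩
      have a2 := hx' ⟨(g ⟨r.1 / 3, h⟩).1.1, by omega⟩
      have a3 := hx' ⟨(g ⟨r.1 / 3, h⟩).2.1, by omega⟩
      by_cases hab : (g ⟨r.1 / 3, h⟩).1.1 = (g ⟨r.1 / 3, h⟩).2.1
      · simp only [hab] at *
        split_ifs <;> omega
      · split_ifs <;> omega
    · obtain ⟨r, hr⟩ := r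
      simp only at h
      have : r = 3 * m ∨ r = 3 * m + 1 := by omega
      rcases this with rfl | rfl
      · rw [e3]; omega
      · rw [e4]; omega

lemma norWires_input (n m : ℕ) (g : (k : Fin m) → Fin (n + k.1) × Fin (n + k.1))
    (y : Fin n → Bool) (j : ℕ) (hj : j < n) : norWires n m g y j = y ⟨j, hj⟩ := by
  rw [norWires, dif_pos hj]

lemma norWires_gate (n m : ℕ) (g : (k : Fin m) → Fin (n + k.1) × Fin (n + k.1))
    (y : Fin n → Bool) (k : Fin m) : norWires n m g y (n + k.1) =
      !(norWires n m g y (g k).1.1 || norWires n m g y (g k).2.1) := by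
  obtain ⟨k, hk⟩ := k
  have q : n + k - n = k := by omega
  rw [norWires, dif_neg (by simp), dif_pos (by simpa using hk)]
  simp only
  congr!

lemma wires_eq (n m : ℕ) (g : (k : Fin m) → Fin (n + k.1) × Fin (n + k.1))
    (x : Fin (n + m + 2) → ℤ) (hx : ∀ i, x i ∈ ({0, 1} : Set ℤ))
    (y : Fin n → Bool) (hy : ∀ j : Fin n, x ⟨j.1, by omega⟩ = if y j then 1 else 0)
    (H : ∀ k : Fin m, (x ⟨n + k.1, by omega⟩ = 1 ↔
        x ⟨(g k).1.1, by have := (g k).1.isLt; omega⟩ = 0 ∧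
        x ⟨(g k).2.1, by have := (g k).2.isLt; omega⟩ = 0)) :
    ∀ (j : ℕ) (hj : j < n + m), x ⟨j, by omega⟩ = if norWires n m g y j then 1 else 0 := by
  have hx' : ∀ i, x i = 0 ∨ x i = 1 := fun i => by simpa using hx i
  intro j
  induction j using Nat.strong_induction_on with
  | _ j ih =>
    intro hj
    by_cases h : j < n
    · rw [norWires_input _ _ _ _ _ h]
      exact hy ⟨j, h⟩
    · obtain ⟨k, rfl⟩ : ∃ k, j = n + k := ⟨j - n, by omega⟩
      have hk := H ⟨k, by omega⟩
      have hw := norWires_gate n m g y ⟨k, by omega⟩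
      have l1 := (g ⟨k, by omega⟩).1.isLt
      have l2 := (g ⟨k, by omega⟩).2.isLt
      simp only at hk hw l1 l2
      have i1 := ih _ l1 (by omega)
      have i2 := ih _ l2 (by omega)
      rw [hw]
      rw [i1, i2] at hk
      have a := hx' ⟨n + k, by omega⟩
      clear i1 i2 hw
      generalize norWires n m g y (g ⟨k, by omega⟩).1.1 = p at hk ⊢
      generalize norWires n m g y (g ⟨k, by omega⟩).2.1 = q at hk ⊢
      generalize x ⟨n + k, by omega⟩ = z at hk a ⊢
      revert hk
      rcases a with rfl | rfl <;> cases p <;> cases q <;> simp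

/-- Lemma: circuit to inequalities.
For any NOR circuit `C` with `n` inputs and `m ≥ 1` gates there exist a
`(3m+2) × (n+m+2)` matrix `A` and a vector `c ∈ {-1,0,1}^{n+m+2}` with entries
in `{-1,0,1}` such that: (1) every 0-1 vector `(x₁,…,xₙ)` has a unique 0-1
extension `x` to `n+m+2` coordinates satisfying `A x > 0` entrywise; and
(2) for any 0-1 vector `x` with `A x > 0`, `c·x > 0` iff `C(x₁,…,xₙ) = 1`. -/
theorem stmt_4 (n m : ℕ) (hm : 1 ≤ m)
    (g : (k : Fin m) → Fin (n + k.1) × Fin (n + k.1)) :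
    ∃ (A : Fin (3 * m + 2) → Fin (n + m + 2) → ℤ) (c : Fin (n + m + 2) → ℤ),
      (∀ r i, A r i ∈ ({-1, 0, 1} : Set ℤ)) ∧
      (∀ i, c i ∈ ({-1, 0, 1} : Set ℤ)) ∧
      (∀ x₀ : Fin n → ℤ, (∀ j, x₀ j ∈ ({0, 1} : Set ℤ)) →
        ∃! x : Fin (n + m + 2) → ℤ,
          (∀ i, x i ∈ ({0, 1} : Set ℤ)) ∧
          (∀ j : Fin n, x ⟨j.1, by have := j.isLt; omega⟩ = x₀ j) ∧
          (∀ r, 0 < ∑ i, A r i * x i)) ∧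
      (∀ x : Fin (n + m + 2) → ℤ, (∀ i, x i ∈ ({0, 1} : Set ℤ)) →
        (∀ r, 0 < ∑ i, A r i * x i) →
        ((0 < ∑ i, c i * x i) ↔
          norWires n m g
            (fun j : Fin n => decide (x ⟨j.1, by have := j.isLt; omega⟩ = 1))
            (n + m - 1) = true)) := by
  refine ⟨rowA n m g, dl (n + m - 1), rowA_mem n m g, ?_, ?_, ?_⟩
  · intro i
    unfold dl
    split_ifs <;> simp
  · intro x₀ h₀
    have h₀' : ∀ i, x₀ i = 0 ∨ x₀ i = 1 := fun i => by simpa using h₀ i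
    have hy0 : ∀ j, x₀ j = if decide (x₀ j = 1) = true then 1 else 0 := by
      intro j
      rcases h₀' j with h | h <;> simp [h]
    let y : Fin n → Bool := fun j => decide (x₀ j = 1)
    let x : Fin (n + m + 2) → ℤ := fun i =>
      if i.1 < n + m then (if norWires n m g y i.1 then 1 else 0) else 1
    have hx : ∀ i, x i ∈ ({0, 1} : Set ℤ) := by
      intro i
      simp only [x]
      split_ifs <;> simp
    refine ⟨x, ⟨hx, ?_, ?_⟩, ?_⟩
    · intro j
      have : j.1 < n + m := by omega
      simp only [x, this, if_true, norWires_input n m g y j.1 j.2]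
      exact (hy0 j).symm
    · rw [rows_iff n m g x hx]
      refine ⟨by simp [x], by simp [x], fun k => ?_⟩
      have l1 : (g k).1.1 < n + m := by omega
      have l2 : (g k).2.1 < n + m := by omega
      have l3 : n + k.1 < n + m := by omega
      simp only [x, l1, l2, l3, if_true, norWires_gate]
      cases norWires n m g y (g k).1.1 <;>
        cases norWires n m g y (g k).2.1 <;> simp
    · rintro x' ⟨hx', hin, hr⟩
      rw [rows_iff n m g x' hx'] at hr
      obtain ⟨t1, u1, H⟩ := hr
      have W := wires_eq n m g x' hx' y (fun j => (hin j).trans (hy0 j)) H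
      funext ⟨i, hi⟩
      by_cases h : i < n + m
      · simp only [x, h, if_true]
        exact W i h
      · simp only [x, h, if_false]
        have : i = n + m ∨ i = n + m + 1 := by omega
        rcases this with rfl | rfl
        · exact t1
        · exact u1
  · intro x hx hr
    rw [rows_iff n m g x hx] at hr
    obtain ⟨t1, u1, H⟩ := hr
    rw [sum_dl _ (by omega), wires_eq n m g x hx
      (fun j : Fin n => decide (x ⟨j.1, by have := j.isLt; omega⟩ = 1)) ?_ H _ (by omega)]
    · split_ifs with h <;> simp [h]
    · intro j
      have : x ⟨j.1, by omega⟩ = 0 ∨ x ⟨j.1, by omega⟩ = 1 := by simpa using hx ⟨j.1, by omega⟩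
      rcases this with h | h <;> simp [h]
end

section
/- Let Ax > 0 be a system of m linear inequalities in n ≥ 2 variables, where A is an m × n matrix with entries in {−1, 0, +1}. Then there exists a system By = 1 of mn − m + 1 linear equations in 2mn − 3m + n + 1 variables (where 1 denotes the all-ones right-hand side vector), with B having entries in {−1, 0, +1}, together with a bijection f from the set of 0-1 vectors x ∈ {0,1}^n satisfying Ax > 0 entrywise onto the set of 0-1 vectors y ∈ {0,1}^{2mn−3m+n+1} satisfying By = 1, such that y_j = x_j for all 1 ≤ j ≤ n whenever y = f(x). -/
/-- Index type of the additional variables. -/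
abbrev ExtraIx (m k : ℕ) : Type := Unit ⊕ ((Fin m × Fin (k + 1)) ⊕ (Fin m × Fin k))

/-- Index type of the equations. -/
abbrev RowIx (m k : ℕ) : Type := Unit ⊕ (Fin m ⊕ (Fin m × Fin k))

/-- The matrix of the system of equations, on structured index types. -/
def bigB {m k : ℕ} (A : Fin m → Fin (k + 2) → ℤ) :
    RowIx m k → (Fin (k + 2) ⊕ ExtraIx m k) → ℤ
  | .inl _, .inl _ => 0
  | .inl _, .inr (.inl _) => 1
  | .inl _, .inr (.inr _) => 0
  | .inr (.inl r), .inl j => A r j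
  | .inr (.inl _), .inr (.inl _) => 0
  | .inr (.inl r), .inr (.inr (.inl p)) => if p.1 = r then -1 else 0
  | .inr (.inl _), .inr (.inr (.inr _)) => 0
  | .inr (.inr _), .inl _ => 0
  | .inr (.inr _), .inr (.inl _) => 1
  | .inr (.inr q), .inr (.inr (.inl p)) =>
      (if p = (q.1, q.2.castSucc) then 1 else 0) - (if p = (q.1, q.2.succ) then 1 else 0)
  | .inr (.inr q), .inr (.inr (.inr p)) => if p = q then -1 else 0

lemma bigB_mem {m k : ℕ} (A : Fin m → Fin (k + 2) → ℤ)
    (hA : ∀ r j, A r j ∈ ({-1, 0, 1} : Set ℤ)) (r : RowIx m k)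
    (j : Fin (k + 2) ⊕ ExtraIx m k) : bigB A r j ∈ ({-1, 0, 1} : Set ℤ) := by
  rcases r with _ | r | q <;> rcases j with j | _ | p | p <;> simp only [bigB]
  case inr.inl.inl => exact hA r j
  all_goals (try split_ifs) <;> simp

lemma row0 {m k : ℕ} (A : Fin m → Fin (k + 2) → ℤ) (y : Fin (k + 2) ⊕ ExtraIx m k → ℤ) :
    ∑ j, bigB A (.inl ()) j * y j = y (.inr (.inl ())) := by
  simp [Fintype.sum_sum_type, bigB]

lemma row1 {m k : ℕ} (A : Fin m → Fin (k + 2) → ℤ) (y : Fin (k + 2) ⊕ ExtraIx m k → ℤ)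
    (r : Fin m) :
    ∑ j, bigB A (.inr (.inl r)) j * y j =
      ∑ j, A r j * y (.inl j) - ∑ i, y (.inr (.inr (.inl (r, i)))) := by
  have h : ∑ p : Fin m × Fin (k + 1), (if p.1 = r then (-1 : ℤ) else 0) *
      y (.inr (.inr (.inl p))) = - ∑ i, y (.inr (.inr (.inl (r, i)))) := by
    rw [Fintype.sum_prod_type, Finset.sum_eq_single r]
    · simp
    · intro b _ hb
      simp [hb]
    · simp
  simp only [Fintype.sum_sum_type, bigB, h]
  simp
  ring

lemma row2 {m k : ℕ} (A : Fin m → Fin (k + 2) → ℤ) (y : Fin (k + 2) ⊕ ExtraIx m k → ℤ)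
    (r : Fin m) (i : Fin k) :
    ∑ j, bigB A (.inr (.inr (r, i))) j * y j =
      y (.inr (.inl ())) + (y (.inr (.inr (.inl (r, i.castSucc))))
        - y (.inr (.inr (.inl (r, i.succ)))) - y (.inr (.inr (.inr (r, i))))) := by
  simp only [Fintype.sum_sum_type, bigB, sub_mul, Finset.sum_sub_distrib, ite_mul,
    Finset.sum_ite_eq', Finset.sum_ite_eq, Finset.mem_univ, if_true]
  simp
  ring

lemma zeroOne_antitone_le {N : ℕ} (s t : Fin N → ℤ) (hs : ∀ i, s i = 0 ∨ s i = 1)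
    (ht : ∀ i, t i = 0 ∨ t i = 1) (as : Antitone s) (at' : Antitone t)
    (h : ∑ i, s i = ∑ i, t i) (i : Fin N) : s i ≤ t i := by
  by_contra hc
  have h1 : s i = 1 ∧ t i = 0 := by
    rcases hs i with h | h <;> rcases ht i with h' | h' <;> omega
  have : ∑ j, t j < ∑ j, s j := by
    apply Finset.sum_lt_sum
    · intro j _
      rcases le_total j i with hj | hj
      · have := as hj
        rcases ht j with h' | h' <;> omega
      · have := at' hj
        rcases hs j with h' | h' <;> omega
    · exact ⟨i, Finset.mem_univ _, by omega⟩
  omega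

lemma antitone_unique {N : ℕ} (s t : Fin N → ℤ) (hs : ∀ i, s i = 0 ∨ s i = 1)
    (ht : ∀ i, t i = 0 ∨ t i = 1) (as : Antitone s) (at' : Antitone t)
    (h : ∑ i, s i = ∑ i, t i) : s = t :=
  funext fun i => le_antisymm (zeroOne_antitone_le s t hs ht as at' h i)
    (zeroOne_antitone_le t s ht hs at' as h.symm i)

lemma sum_thr (N : ℕ) (S : ℤ) (h0 : 0 ≤ S) (h1 : S ≤ N) :
    ∑ i : Fin N, (if ((i : ℕ) : ℤ) < S then (1 : ℤ) else 0) = S := by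
  rw [Fin.sum_univ_eq_sum_range (fun i => if (i : ℤ) < S then (1 : ℤ) else 0)]
  lift S to ℕ using h0
  have h1 : S ≤ N := by exact_mod_cast h1
  simp only [Nat.cast_lt]
  rw [Finset.sum_boole]
  have : (Finset.range N).filter (· < S) = Finset.range S := by
    ext a; simp; omega
  rw [this]; simp

lemma core_sound {m k : ℕ} (A : Fin m → Fin (k + 2) → ℤ)
    (y : Fin (k + 2) ⊕ ExtraIx m k → ℤ) (hy : ∀ j, y j ∈ ({0, 1} : Set ℤ))
    (h : ∀ r, ∑ j, bigB A r j * y j = 1) (r : Fin m) : 0 < ∑ j, A r j * y (.inl j) := by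
  have h1 := h (.inr (.inl r))
  rw [row1] at h1
  have : 0 ≤ ∑ i, y (.inr (.inr (.inl (r, i)))) := by
    apply Finset.sum_nonneg
    intro i _
    have := hy (.inr (.inr (.inl (r, i))))
    simp at this
    omega
  omega

lemma core_unique {m k : ℕ} (A : Fin m → Fin (k + 2) → ℤ)
    (y z : Fin (k + 2) ⊕ ExtraIx m k → ℤ)
    (hy : ∀ j, y j ∈ ({0, 1} : Set ℤ)) (hz : ∀ j, z j ∈ ({0, 1} : Set ℤ))
    (h : ∀ r, ∑ j, bigB A r j * y j = 1) (h' : ∀ r, ∑ j, bigB A r j * z j = 1)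
    (hx : ∀ j, y (.inl j) = z (.inl j)) : y = z := by
  have key : ∀ y : Fin (k + 2) ⊕ ExtraIx m k → ℤ, (∀ j, y j ∈ ({0, 1} : Set ℤ)) →
      (∀ r, ∑ j, bigB A r j * y j = 1) → y (.inr (.inl ())) = 1 ∧
      (∀ r, ∑ i, y (.inr (.inr (.inl (r, i)))) = ∑ j, A r j * y (.inl j) - 1) ∧
      (∀ r i, y (.inr (.inr (.inr (r, i)))) = y (.inr (.inr (.inl (r, i.castSucc))))
        - y (.inr (.inr (.inl (r, i.succ))))) ∧
      (∀ r, Antitone fun i => y (.inr (.inr (.inl (r, i))))) := by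
    intro y hy h
    have e0 := h (.inl ())
    rw [row0] at e0
    have e2 : ∀ r i, y (.inr (.inr (.inr (r, i)))) = y (.inr (.inr (.inl (r, i.castSucc))))
        - y (.inr (.inr (.inl (r, i.succ)))) := by
      intro r i
      have := h (.inr (.inr (r, i)))
      rw [row2] at this
      omega
    refine ⟨e0, ?_, e2, ?_⟩
    · intro r
      have := h (.inr (.inl r))
      rw [row1] at this
      omega
    · intro r
      rw [Fin.antitone_iff_succ_le]
      intro i
      have h1 := e2 r i
      have h2 := hy (.inr (.inr (.inr (r, i))))
      simp only [Set.mem_insert_iff, Set.mem_singleton_iff] at h2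
      show y (.inr (.inr (.inl (r, i.succ)))) ≤ y (.inr (.inr (.inl (r, i.castSucc))))
      omega
  obtain ⟨a1, a2, a3, a4⟩ := key y hy h
  obtain ⟨b1, b2, b3, b4⟩ := key z hz h'
  have hs : ∀ r i, y (.inr (.inr (.inl (r, i)))) = z (.inr (.inr (.inl (r, i)))) := by
    intro r
    apply congrFun
    apply antitone_unique (fun i => y (.inr (.inr (.inl (r, i)))))
      (fun i => z (.inr (.inr (.inl (r, i))))) (fun i => hy _) (fun i => hz _) (a4 r) (b4 r)
    rw [a2, b2]
    simp only [hx]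
  funext j
  rcases j with j | _ | ⟨r, i⟩ | ⟨r, i⟩
  · exact hx j
  · rw [a1, b1]
  · exact hs r i
  · rw [a3, b3, hs, hs]

lemma core_exists {m k : ℕ} (A : Fin m → Fin (k + 2) → ℤ)
    (hA : ∀ r j, A r j ∈ ({-1, 0, 1} : Set ℤ))
    (x : Fin (k + 2) → ℤ) (hx : ∀ j, x j ∈ ({0, 1} : Set ℤ))
    (hp : ∀ r, 0 < ∑ j, A r j * x j) :
    ∃ y : Fin (k + 2) ⊕ ExtraIx m k → ℤ, (∀ j, y j ∈ ({0, 1} : Set ℤ)) ∧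
      (∀ r, ∑ j, bigB A r j * y j = 1) ∧ ∀ j, y (.inl j) = x j := by
  let S : Fin m → ℤ := fun r => ∑ j, A r j * x j - 1
  let s : Fin m → ℕ → ℤ := fun r i => if (i : ℤ) < S r then 1 else 0
  refine ⟨Sum.elim x (Sum.elim (fun _ => 1) (Sum.elim (fun p => s p.1 p.2)
    (fun p => s p.1 p.2 - s p.1 (p.2 + 1)))), ?_, ?_, ?_⟩
  · rintro (j | _ | ⟨r, i⟩ | ⟨r, i⟩)
    · exact hx j
    · simp
    · simp only [Sum.elim_inr, Sum.elim_inl, s]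
      split_ifs <;> simp
    · simp only [Sum.elim_inr, s]
      push_cast
      split_ifs <;> first | (exfalso; omega) | simp
  · rintro (_ | r | ⟨r, i⟩)
    · rw [row0]; simp
    · rw [row1]
      simp only [Sum.elim_inr, Sum.elim_inl, s]
      rw [sum_thr]
      · simp [S]
      · have := hp r
        simp only [S]; omega
      · have : ∑ j, A r j * x j ≤ ∑ j : Fin (k + 2), (1 : ℤ) := by
          apply Finset.sum_le_sum
          intro j _
          have h1 := hA r j
          have h2 := hx j
          simp only [Set.mem_insert_iff, Set.mem_singleton_iff] at h1 h2
          rcases h1 with h1 | h1 | h1 <;> rcases h2 with h2 | h2 <;> simp [h1, h2]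
        simp at this
        simp only [S]; push_cast; omega
    · rw [row2]; simp
  · intro j; rfl


/-- Lemma: slack variables, inequalities to equations.
Given a system `A x > 0` of `m` inequalities in `n ≥ 2` variables with `A`
having entries in `{-1,0,1}`, there is a system `B y = 1` of `m*n - m + 1`
equations in `2*m*n - 3*m + n + 1` variables with `B` having entries in
`{-1,0,1}`, together with a bijection `f` from the 0-1 solutions of `A x > 0`
onto the 0-1 solutions of `B y = 1` with `(f x) j = x j` for `j < n`. -/
theorem stmt_5 (m n : ℕ) (hn : 2 ≤ n) (A : Fin m → Fin n → ℤ)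
    (hA : ∀ r j, A r j ∈ ({-1, 0, 1} : Set ℤ)) :
    ∃ (B : Fin (m * n - m + 1) → Fin (2 * m * n - 3 * m + n + 1) → ℤ)
      (f : {x : Fin n → ℤ //
              (∀ j, x j ∈ ({0, 1} : Set ℤ)) ∧ ∀ r, 0 < ∑ j, A r j * x j} →
           {y : Fin (2 * m * n - 3 * m + n + 1) → ℤ //
              (∀ j, y j ∈ ({0, 1} : Set ℤ)) ∧ ∀ r, ∑ j, B r j * y j = 1}),
      (∀ r j, B r j ∈ ({-1, 0, 1} : Set ℤ)) ∧
      Function.Bijective f ∧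
      (∀ x (j : Fin n),
        (f x).1 (Fin.castLE
          (Nat.le_succ_of_le (Nat.le_add_left n (2 * m * n - 3 * m))) j)
          = x.1 j) := by
  obtain ⟨k, rfl⟩ : ∃ k, n = k + 2 := ⟨n - 2, by omega⟩
  have cR : Fintype.card (RowIx m k) = m * (k + 2) - m + 1 := by
    simp only [Fintype.card_sum, Fintype.card_prod, Fintype.card_fin, Fintype.card_unit]
    have : m * (k + 2) = m * k + 2 * m := by ring
    omega
  have cE : (k + 2) + Fintype.card (ExtraIx m k) = 2 * m * (k + 2) - 3 * m + (k + 2) + 1 := by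
    simp only [Fintype.card_sum, Fintype.card_prod, Fintype.card_fin, Fintype.card_unit]
    have h1 : 2 * m * (k + 2) = 2 * (m * k) + 4 * m := by ring
    have h2 : m * (k + 1) = m * k + m := by ring
    omega
  let eR : RowIx m k ≃ Fin (m * (k + 2) - m + 1) := Fintype.equivFinOfCardEq cR
  let eJ : (Fin (k + 2) ⊕ ExtraIx m k) ≃ Fin (2 * m * (k + 2) - 3 * m + (k + 2) + 1) :=
    ((Equiv.sumCongr (Equiv.refl _) (Fintype.equivFin _)).trans finSumFinEquiv).trans
      (finCongr cE)
  have heJ : ∀ j : Fin (k + 2), eJ (.inl j) = Fin.castLE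
      (Nat.le_succ_of_le (Nat.le_add_left (k + 2) (2 * m * (k + 2) - 3 * m))) j := by
    intro j
    apply Fin.ext
    simp [eJ]
  have hsum : ∀ (r : Fin (m * (k + 2) - m + 1))
      (y : Fin (2 * m * (k + 2) - 3 * m + (k + 2) + 1) → ℤ),
      ∑ j, bigB A (eR.symm r) (eJ.symm j) * y j
        = ∑ j, bigB A (eR.symm r) j * y (eJ j) := by
    intro r y
    rw [← eJ.sum_comp]
    simp
  have hex : ∀ x : {x : Fin (k + 2) → ℤ //
      (∀ j, x j ∈ ({0, 1} : Set ℤ)) ∧ ∀ r, 0 < ∑ j, A r j * x j},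
      ∃ y : {y : Fin (2 * m * (k + 2) - 3 * m + (k + 2) + 1) → ℤ //
        (∀ j, y j ∈ ({0, 1} : Set ℤ)) ∧
          ∀ r, ∑ j, bigB A (eR.symm r) (eJ.symm j) * y j = 1},
      ∀ j, y.1 (eJ (.inl j)) = x.1 j := by
    rintro ⟨x, hx, hp⟩
    obtain ⟨y, hy, hB, hr⟩ := core_exists A hA x hx hp
    refine ⟨⟨fun j => y (eJ.symm j), fun j => hy _, fun r => ?_⟩, fun j => ?_⟩
    · rw [hsum]
      simpa using hB (eR.symm r)
    · simpa using hr j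
  choose f hf using hex
  have hsol : ∀ y : {y : Fin (2 * m * (k + 2) - 3 * m + (k + 2) + 1) → ℤ //
        (∀ j, y j ∈ ({0, 1} : Set ℤ)) ∧
          ∀ r, ∑ j, bigB A (eR.symm r) (eJ.symm j) * y j = 1},
      ∀ r, ∑ j, bigB A r j * y.1 (eJ j) = 1 := by
    intro y r
    have := y.2.2 (eR r)
    rw [hsum] at this
    simpa using this
  refine ⟨fun r j => bigB A (eR.symm r) (eJ.symm j), f, fun r j => bigB_mem A hA _ _,
    ⟨?_, ?_⟩, ?_⟩
  · intro x x' h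
    apply Subtype.ext
    funext j
    rw [← hf x j, ← hf x' j, h]
  · intro y
    have hx : ∀ r, 0 < ∑ j, A r j * y.1 (eJ (.inl j)) := fun r =>
      core_sound A (fun j => y.1 (eJ j)) (fun j => y.2.1 _) (hsol y) r
    let x : {x : Fin (k + 2) → ℤ //
      (∀ j, x j ∈ ({0, 1} : Set ℤ)) ∧ ∀ r, 0 < ∑ j, A r j * x j} :=
      ⟨fun j => y.1 (eJ (.inl j)), fun j => y.2.1 _, hx⟩
    refine ⟨x, ?_⟩
    · apply Subtype.ext
      have := core_unique A (fun j => (f x).1 (eJ j)) (fun j => y.1 (eJ j))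
        (fun j => (f x).2.1 (eJ j)) (fun j => y.2.1 (eJ j))
        (hsol (f x)) (hsol y) (fun j => hf x j)
      funext j
      have h := congrFun this (eJ.symm j)
      simpa using h
  · intro x j
    rw [← heJ]
    exact hf x j
end
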